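/- Let γ be a queenon, N ∈ ℕ, ε > 0, and let q be an n-queens configuration such that for every α ∈ I_N the number of elements of q in α_n equals (γ(α) ± ε)n, i.e. | |α_n ∩ q| − γ(α)n | ≤ εn. Then d(γ_q, γ) ≤ 4N²(ε + 8/n) + 8/N. -/

import Mathlib

open MeasureTheory Filter Topology
open scoped ENNReal

noncomputable section

/-- The square `[-1/2,1/2]²`. -/
def unitSq : Set (ℝ × ℝ) :=
  Set.Icc (-(1:ℝ)/2) (1/2) ×ˢ Set.Icc (-(1:ℝ)/2) (1/2)

/-- The square `σ_{i,j}^N` (for `i, j ∈ [N]`). -/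
def gridSq (N i j : ℕ) : Set (ℝ × ℝ) :=
  Set.Icc (-(1:ℝ)/2 + ((i:ℝ) - 1)/N) (-(1:ℝ)/2 + (i:ℝ)/N) ×ˢ
    Set.Icc (-(1:ℝ)/2 + ((j:ℝ) - 1)/N) (-(1:ℝ)/2 + (j:ℝ)/N)

/-- The cell of the partition `I_N` with index `i, j ∈ [2N]`. -/
def INcell (N i j : ℕ) : Set (ℝ × ℝ) :=
  {p ∈ unitSq | (-1 + ((i:ℝ) - 1)/N ≤ p.1 + p.2 ∧ p.1 + p.2 ≤ -1 + (i:ℝ)/N) ∧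
    (-1 + ((j:ℝ) - 1)/N ≤ p.2 - p.1 ∧ p.2 - p.1 ≤ -1 + (j:ℝ)/N)}

/-- The interval of the partition `J_N` of `[-1,1]` with index `i ∈ [2N]`. -/
def JNcell (N i : ℕ) : Set ℝ :=
  Set.Icc (-1 + ((i:ℝ) - 1)/N) (-1 + (i:ℝ)/N)

/-- A member of the family `R` of subsets of the square. -/
def Rset (a₁ b₁ a₂ b₂ : ℝ) : Set (ℝ × ℝ) :=
  {p ∈ unitSq | (a₁ ≤ p.1 + p.2 ∧ p.1 + p.2 ≤ b₁) ∧ (a₂ ≤ p.2 - p.1 ∧ p.2 - p.1 ≤ b₂)}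

/-- The distance `d` between two Borel measures on the square: the supremum of
`|γ₁(α) − γ₂(α)|` over `α ∈ R`. -/
def qdist (μ ν : Measure (ℝ × ℝ)) : ℝ :=
  sSup {t : ℝ | ∃ a₁ b₁ a₂ b₂ : ℝ, a₁ ∈ Set.Icc (-1:ℝ) 1 ∧ b₁ ∈ Set.Icc (-1:ℝ) 1 ∧
    a₂ ∈ Set.Icc (-1:ℝ) 1 ∧ b₂ ∈ Set.Icc (-1:ℝ) 1 ∧
    t = |(μ (Rset a₁ b₁ a₂ b₂)).toReal - (ν (Rset a₁ b₁ a₂ b₂)).toReal|}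

/-- A permuton: a Borel probability measure on the square with uniform marginals. -/
def IsPermuton (μ : Measure (ℝ × ℝ)) : Prop :=
  IsProbabilityMeasure μ ∧ μ unitSqᶜ = 0 ∧
  ∀ a b : ℝ, -(1:ℝ)/2 ≤ a → a ≤ b → b ≤ 1/2 →
    μ (Set.Icc a b ×ˢ Set.Icc (-(1:ℝ)/2) (1/2)) = ENNReal.ofReal (b - a) ∧
    μ (Set.Icc (-(1:ℝ)/2) (1/2) ×ˢ Set.Icc a b) = ENNReal.ofReal (b - a)

/-- An `N`-step permuton: a permuton with constant density on each square `σ_{i,j}^N`. -/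
def IsStepPermutonN (N : ℕ) (μ : Measure (ℝ × ℝ)) : Prop :=
  IsPermuton μ ∧
  ∀ i ∈ Finset.Icc 1 N, ∀ j ∈ Finset.Icc 1 N, ∃ c : ℝ≥0∞,
    ∀ s : Set (ℝ × ℝ), s ⊆ gridSq N i j → MeasurableSet s → μ s = c * volume s

/-- A step permuton. -/
def IsStepPermuton (μ : Measure (ℝ × ℝ)) : Prop :=
  ∃ N : ℕ, 0 < N ∧ IsStepPermutonN N μ

/-- Sub-uniform diagonal marginals. -/
def SubUniformDiag (μ : Measure (ℝ × ℝ)) : Prop :=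
  ∀ a b : ℝ, -1 ≤ a → a ≤ b → b ≤ 1 →
    μ {p ∈ unitSq | a ≤ p.1 + p.2 ∧ p.1 + p.2 ≤ b} ≤ ENNReal.ofReal (b - a) ∧
    μ {p ∈ unitSq | a ≤ p.2 - p.1 ∧ p.2 - p.1 ≤ b} ≤ ENNReal.ofReal (b - a)

/-- The set `Γ` of queenons: the closure, in the topology of weak convergence of Borel
probability measures, of the set of step permutons with sub-uniform diagonal marginals. -/
def queenons : Set (ProbabilityMeasure (ℝ × ℝ)) :=
  closure {μ : ProbabilityMeasure (ℝ × ℝ) |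
    IsStepPermuton μ.toMeasure ∧ SubUniformDiag μ.toMeasure}

/-- The pushforward `γ⁺` of `γ` under `(x,y) ↦ x+y`. -/
def diagPlus (γ : Measure (ℝ × ℝ)) : Measure ℝ := γ.map fun p => p.1 + p.2

/-- The pushforward `γ⁻` of `γ` under `(x,y) ↦ y−x`. -/
def diagMinus (γ : Measure (ℝ × ℝ)) : Measure ℝ := γ.map fun p => p.2 - p.1

/-- The measure `γ̄⁺` on `[-1,1]`, with `γ̄⁺([a,b]) = (b−a) − γ⁺([a,b])`. -/
def barPlus (γ : Measure (ℝ × ℝ)) : Measure ℝ :=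
  volume.restrict (Set.Icc (-1:ℝ) 1) - diagPlus γ

/-- The measure `γ̄⁻` on `[-1,1]`, with `γ̄⁻([a,b]) = (b−a) − γ⁻([a,b])`. -/
def barMinus (γ : Measure (ℝ × ℝ)) : Measure ℝ :=
  volume.restrict (Set.Icc (-1:ℝ) 1) - diagMinus γ

/-- The uniform probability measure on `[-1,1]` (density `1/2`). -/
def unif11 : Measure ℝ := (2 : ℝ≥0∞)⁻¹ • volume.restrict (Set.Icc (-1:ℝ) 1)

open Classical in
/-- The Kullback–Leibler divergence of `μ` with respect to `ν`, as an extended real: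
`∫ log (dμ/dν) dμ` if `μ ≪ ν` and the integrand is integrable, and `+∞` otherwise. -/
def DKL {X : Type*} [MeasurableSpace X] (μ ν : Measure X) : EReal :=
  if μ ≪ ν ∧ Integrable (fun x => Real.log (μ.rnDeriv ν x).toReal) μ then
    ((∫ x, Real.log (μ.rnDeriv ν x).toReal ∂μ : ℝ) : EReal)
  else ⊤

/-- The Q-entropy `H_q(γ) = −D_KL(γ) − D_KL(γ̄⁺) − D_KL(γ̄⁻) + 2 log 2 − 3`. -/
def Hq (γ : Measure (ℝ × ℝ)) : EReal :=
  -DKL γ (volume.restrict unitSq) - DKL (barPlus γ) unif11 - DKL (barMinus γ) unif11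
    + ((2 * Real.log 2 - 3 : ℝ) : EReal)

/-- The discrete approximation `H_q^N` of the Q-entropy. -/
def HqN (N : ℕ) (γ : Measure (ℝ × ℝ)) : ℝ :=
  -(∑ i ∈ Finset.Icc 1 (2*N), ∑ j ∈ Finset.Icc 1 (2*N),
      (γ (INcell N i j)).toReal *
        Real.log ((γ (INcell N i j)).toReal / (volume (INcell N i j)).toReal))
  - (∑ i ∈ Finset.Icc 1 (2*N),
      (barPlus γ (JNcell N i)).toReal *
        Real.log ((2*N : ℝ) * (barPlus γ (JNcell N i)).toReal))
  - (∑ i ∈ Finset.Icc 1 (2*N),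
      (barMinus γ (JNcell N i)).toReal *
        Real.log ((2*N : ℝ) * (barMinus γ (JNcell N i)).toReal))
  + 2 * Real.log 2 - 3

/-- An `n`-queens configuration: a subset of `[n]² = {1,…,n}²` with exactly one element in
each row and column and at most one element in each plus- and minus-diagonal. -/
def IsQueensConfig (n : ℕ) (q : Finset (ℕ × ℕ)) : Prop :=
  (∀ p ∈ q, p.1 ∈ Finset.Icc 1 n ∧ p.2 ∈ Finset.Icc 1 n) ∧
  (∀ y ∈ Finset.Icc 1 n, ∃! x : ℕ, (x, y) ∈ q) ∧
  (∀ x ∈ Finset.Icc 1 n, ∃! y : ℕ, (x, y) ∈ q) ∧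
  (∀ p ∈ q, ∀ p' ∈ q, p.1 + p.2 = p'.1 + p'.2 → p = p') ∧
  (∀ p ∈ q, ∀ p' ∈ q, (p.2 : ℤ) - (p.1 : ℤ) = (p'.2 : ℤ) - (p'.1 : ℤ) → p = p')

/-- `Q(n)`, the number of `n`-queens configurations. -/
def numQueens (n : ℕ) : ℕ :=
  Set.ncard {q : Finset (ℕ × ℕ) | IsQueensConfig n q}

/-- The measure `γ_q` associated to an `n`-queens configuration `q`: density `n` on each
square `σ_{i,j}^n` with `(i,j) ∈ q`, and `0` elsewhere. -/
def gammaOf (n : ℕ) (q : Finset (ℕ × ℕ)) : Measure (ℝ × ℝ) :=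
  volume.withDensity ((⋃ ij ∈ q, gridSq n ij.1 ij.2).indicator fun _ => (n : ℝ≥0∞))

/-- The set `B_n(γ,ε)` of `n`-queens configurations `q` with `d(γ_q, γ) < ε`. -/
def Bset (n : ℕ) (γ : Measure (ℝ × ℝ)) (ε : ℝ) : Set (Finset (ℕ × ℕ)) :=
  {q | IsQueensConfig n q ∧ qdist (gammaOf n q) γ < ε}

/-- `|B_n(γ,ε)|`. -/
def Bcard (n : ℕ) (γ : Measure (ℝ × ℝ)) (ε : ℝ) : ℕ := (Bset n γ ε).ncard

/-- The exponential of an extended real, with `exp(−∞) = 0`. -/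
def expEReal (x : EReal) : ℝ := if x = ⊥ then 0 else Real.exp x.toReal

open Classical in
/-- The index `(a,b) ∈ [2N]²` of the cell of `I_N` to which the position `(i,j) ∈ [n]²` is
assigned: among the cells of `I_N` meeting `σ_{i,j}^n`, the one whose center-point is
lexicographically minimal (equivalently, minimizing `(a−b, b)` lexicographically). -/
def cellIndex (N n : ℕ) (ij : ℕ × ℕ) : ℕ × ℕ :=
  let cand : Finset (ℕ × ℕ) :=
    (Finset.Icc 1 (2*N) ×ˢ Finset.Icc 1 (2*N)).filter fun ab =>
      (INcell N ab.1 ab.2 ∩ gridSq n ij.1 ij.2).Nonempty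
  let keyFn : ℕ × ℕ → ℤ ×ₗ ℤ := fun ab => toLex ((ab.1 : ℤ) - (ab.2 : ℤ), (ab.2 : ℤ))
  if h : cand.Nonempty then
    let key := (cand.image keyFn).min' (h.image keyFn)
    (((ofLex key).1 + (ofLex key).2).toNat, ((ofLex key).2).toNat)
  else (0, 0)

/-- The set `α_n ⊆ [n]²` associated to the cell `α ∈ I_N` with index `(a,b)`. -/
def alphaFin (N n : ℕ) (a b : ℕ) : Finset (ℕ × ℕ) :=
  (Finset.Icc 1 n ×ˢ Finset.Icc 1 n).filter fun ij => cellIndex N n ij = (a, b)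

lemma mem_unitSq {p : ℝ × ℝ} : p ∈ unitSq ↔
    (-(1:ℝ)/2 ≤ p.1 ∧ p.1 ≤ 1/2) ∧ (-(1:ℝ)/2 ≤ p.2 ∧ p.2 ≤ 1/2) := Iff.rfl

lemma isClosed_unitSq : IsClosed unitSq := isClosed_Icc.prod isClosed_Icc

lemma isClosed_gridSq (n i j : ℕ) : IsClosed (gridSq n i j) := isClosed_Icc.prod isClosed_Icc

lemma isClosed_Rset (a₁ b₁ a₂ b₂ : ℝ) : IsClosed (Rset a₁ b₁ a₂ b₂) := by
  have : Rset a₁ b₁ a₂ b₂ = unitSq ∩ (((fun p : ℝ × ℝ => p.1 + p.2) ⁻¹' Set.Icc a₁ b₁) ∩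
      ((fun p : ℝ × ℝ => p.2 - p.1) ⁻¹' Set.Icc a₂ b₂)) := rfl
  rw [this]
  exact isClosed_unitSq.inter ((isClosed_Icc.preimage (by fun_prop)).inter
    (isClosed_Icc.preimage (by fun_prop)))

lemma isClosed_INcell (N i j : ℕ) : IsClosed (INcell N i j) := isClosed_Rset _ _ _ _

/-! ### Queenons -/

/-- Upper bounds on the mass of an open set pass to the weak closure. -/
lemma measure_le_of_mem_closure {X : Type*} [TopologicalSpace X] [MeasurableSpace X]
    [OpensMeasurableSpace X] [HasOuterApproxClosed X] {S : Set (ProbabilityMeasure X)}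
    {γ : ProbabilityMeasure X} (hγ : γ ∈ closure S) {G : Set X} (hG : IsOpen G) {c : ℝ≥0∞}
    (h : ∀ μ ∈ S, μ.toMeasure G ≤ c) : γ.toMeasure G ≤ c := by
  obtain ⟨u, hu, hlim⟩ := mem_closure_iff_ultrafilter.mp hγ
  have key := ProbabilityMeasure.le_liminf_measure_open_of_tendsto
    (μs := id) (L := (u : Filter (ProbabilityMeasure X))) (tendsto_id'.mpr hlim) hG
  refine key.trans ((liminf_le_liminf (v := fun _ => c) ?_).trans_eq (by simp))
  filter_upwards [hu] with μ hμ using h μ hμ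

/-- A bound for closed strips inside `unitSq` with `-1 ≤ a ≤ b ≤ 1` extends to all closed
strips of the closure. -/
lemma closure_strip_le {S : Set (ProbabilityMeasure (ℝ × ℝ))} {γ : ProbabilityMeasure (ℝ × ℝ)}
    (hγ : γ ∈ closure S) {f : ℝ × ℝ → ℝ} (hf : Continuous f)
    (hrange : ∀ p ∈ unitSq, f p ∈ Set.Icc (-1:ℝ) 1)
    (hsq : ∀ μ ∈ S, μ.toMeasure unitSqᶜ = 0)
    (hS : ∀ μ ∈ S, ∀ a b : ℝ, -1 ≤ a → a ≤ b → b ≤ 1 →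
      μ.toMeasure {p ∈ unitSq | a ≤ f p ∧ f p ≤ b} ≤ ENNReal.ofReal (b - a))
    {a b : ℝ} (hab : a ≤ b) :
    γ.toMeasure.real {p | a ≤ f p ∧ f p ≤ b} ≤ b - a := by
  refine le_of_forall_pos_le_add fun δ hδ => ?_
  have hopen : IsOpen {p | a - δ/2 < f p ∧ f p < b + δ/2} :=
    (isOpen_lt continuous_const hf).inter (isOpen_lt hf continuous_const)
  have key : γ.toMeasure {p | a - δ/2 < f p ∧ f p < b + δ/2} ≤
      ENNReal.ofReal (b - a + δ) := by
    refine measure_le_of_mem_closure hγ hopen fun μ hμ => ?_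
    have hsub : {p | a - δ/2 < f p ∧ f p < b + δ/2} ⊆
        {p ∈ unitSq | max (a - δ/2) (-1) ≤ f p ∧ f p ≤ min (b + δ/2) 1} ∪ unitSqᶜ := by
      rintro p ⟨h1, h2⟩
      by_cases hp : p ∈ unitSq
      · obtain ⟨h3, h4⟩ := hrange p hp
        exact Or.inl ⟨hp, max_le h1.le h3, le_min h2.le h4⟩
      · exact Or.inr hp
    refine (measure_mono hsub).trans ((measure_union_le _ _).trans ?_)
    rw [hsq μ hμ, add_zero]
    by_cases hle : max (a - δ/2) (-1) ≤ min (b + δ/2) 1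
    · refine (hS μ hμ _ _ (le_max_right _ _) hle (min_le_right _ _)).trans
        (ENNReal.ofReal_le_ofReal ?_)
      linarith [le_max_left (a - δ/2) (-1), min_le_left (b + δ/2) 1]
    · have : {p ∈ unitSq | max (a - δ/2) (-1) ≤ f p ∧ f p ≤ min (b + δ/2) 1} = ∅ :=
        Set.eq_empty_of_forall_notMem fun p hp => hle (hp.2.1.trans hp.2.2)
      rw [this]
      simp
  have hsub : {p | a ≤ f p ∧ f p ≤ b} ⊆ {p | a - δ/2 < f p ∧ f p < b + δ/2} :=
    fun p hp => ⟨by linarith [hp.1], by linarith [hp.2]⟩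
  exact ENNReal.toReal_le_of_le_ofReal (by linarith) ((measure_mono hsub).trans key)

lemma queenon_plus_strip_le {γ : ProbabilityMeasure (ℝ × ℝ)} (hγ : γ ∈ queenons) {a b : ℝ}
    (hab : a ≤ b) : γ.toMeasure.real {p | a ≤ p.1 + p.2 ∧ p.1 + p.2 ≤ b} ≤ b - a := by
  refine closure_strip_le (f := fun p => p.1 + p.2) hγ (by fun_prop) ?_ ?_ ?_ hab
  · intro p hp
    obtain ⟨⟨h1, h2⟩, h3, h4⟩ := mem_unitSq.mp hp
    constructor <;> linarith
  · rintro μ ⟨⟨_, _, hμ, _⟩, _⟩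
    exact hμ.2.1
  · rintro μ ⟨_, hμ⟩ a b h1 h2 h3
    exact (hμ a b h1 h2 h3).1

lemma queenon_minus_strip_le {γ : ProbabilityMeasure (ℝ × ℝ)} (hγ : γ ∈ queenons) {a b : ℝ}
    (hab : a ≤ b) : γ.toMeasure.real {p | a ≤ p.2 - p.1 ∧ p.2 - p.1 ≤ b} ≤ b - a := by
  refine closure_strip_le (f := fun p => p.2 - p.1) hγ (by fun_prop) ?_ ?_ ?_ hab
  · intro p hp
    obtain ⟨⟨h1, h2⟩, h3, h4⟩ := mem_unitSq.mp hp
    constructor <;> linarith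
  · rintro μ ⟨⟨_, _, hμ, _⟩, _⟩
    exact hμ.2.1
  · rintro μ ⟨_, hμ⟩ a b h1 h2 h3
    exact (hμ a b h1 h2 h3).2

/-! ### The partition `I_N` -/

lemma exists_interval_index {N : ℕ} (hN : 0 < N) {u : ℝ} (h1 : -1 ≤ u) (h2 : u ≤ 1) :
    ∃ a ∈ Finset.Icc 1 (2*N), -1 + ((a:ℝ) - 1)/N ≤ u ∧ u ≤ -1 + (a:ℝ)/N := by
  have hN' : (0:ℝ) < N := by exact_mod_cast hN
  have hnn : 0 ≤ (u + 1) * N := by nlinarith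
  rcases lt_or_ge ⌊(u + 1) * N⌋₊ (2*N) with hk | hk
  · refine ⟨⌊(u + 1) * N⌋₊ + 1, by simp; omega, ?_, ?_⟩
    · have := Nat.floor_le hnn
      have h3 : ((⌊(u + 1) * N⌋₊ : ℕ) : ℝ) / N ≤ u + 1 := (div_le_iff₀ hN').mpr this
      push_cast
      rw [add_sub_cancel_right]
      linarith
    · have := (Nat.lt_floor_add_one ((u + 1) * N)).le
      have h3 : u + 1 ≤ (((⌊(u + 1) * N⌋₊ : ℕ) : ℝ) + 1) / N := (le_div_iff₀ hN').mpr this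
      push_cast
      linarith
  · refine ⟨2*N, by simp; omega, ?_, ?_⟩
    · have h3 : ((2*N : ℕ) : ℝ) ≤ (u + 1) * N := (Nat.le_floor_iff hnn).mp hk
      have h4 : (((2*N : ℕ) : ℝ) - 1) / N ≤ u + 1 := (div_le_iff₀ hN').mpr (by linarith)
      linarith
    · have h3 : ((2*N : ℕ) : ℝ) / N = 2 := by push_cast; field_simp
      rw [h3]
      linarith

lemma exists_mem_INcell {N : ℕ} (hN : 0 < N) {p : ℝ × ℝ} (hp : p ∈ unitSq) :
    ∃ a ∈ Finset.Icc 1 (2*N), ∃ b ∈ Finset.Icc 1 (2*N), p ∈ INcell N a b := by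
  obtain ⟨⟨h1, h2⟩, h3, h4⟩ := mem_unitSq.mp hp
  obtain ⟨a, ha, hpa⟩ := exists_interval_index hN (u := p.1 + p.2) (by linarith) (by linarith)
  obtain ⟨b, hb, hpb⟩ := exists_interval_index hN (u := p.2 - p.1) (by linarith) (by linarith)
  exact ⟨a, ha, b, hb, hp, hpa, hpb⟩

/-- Two intervals of `J_N` with distinct indices share at most one point. -/
lemma eq_endpoint_of_mem_intervals {N a a' : ℕ} (h : a < a') {u : ℝ}
    (h1 : u ≤ -1 + (a:ℝ)/N) (h2 : -1 + ((a':ℝ) - 1)/N ≤ u) : u = -1 + (a:ℝ)/N := by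
  refine le_antisymm h1 (le_trans ?_ h2)
  have : (a:ℝ) + 1 ≤ a' := by exact_mod_cast h
  have : (a:ℝ)/N ≤ ((a':ℝ) - 1)/N := by gcongr; linarith
  linarith

lemma queenon_INcell_aedisjoint {γ : ProbabilityMeasure (ℝ × ℝ)} (hγ : γ ∈ queenons) (N : ℕ)
    {x y : ℕ × ℕ} (hxy : x ≠ y) :
    AEDisjoint γ.toMeasure (INcell N x.1 x.2) (INcell N y.1 y.2) := by
  have hplus : ∀ c : ℝ, γ.toMeasure {p | c ≤ p.1 + p.2 ∧ p.1 + p.2 ≤ c} = 0 := fun c =>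
    (measureReal_eq_zero_iff).mp
      (le_antisymm (by simpa using queenon_plus_strip_le hγ (le_refl c)) measureReal_nonneg)
  have hminus : ∀ c : ℝ, γ.toMeasure {p | c ≤ p.2 - p.1 ∧ p.2 - p.1 ≤ c} = 0 := fun c =>
    (measureReal_eq_zero_iff).mp
      (le_antisymm (by simpa using queenon_minus_strip_le hγ (le_refl c)) measureReal_nonneg)
  have main : x.1 < y.1 ∨ y.1 < x.1 ∨ x.2 < y.2 ∨ y.2 < x.2 := by
    by_contra! hcon
    exact hxy (Prod.ext (by omega) (by omega))
  rcases main with h | h | h | h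
  · refine measure_mono_null ?_ (hplus (-1 + (x.1:ℝ)/N))
    rintro p ⟨⟨_, hp, _⟩, ⟨_, hp', _⟩⟩
    have := eq_endpoint_of_mem_intervals h hp.2 hp'.1
    exact ⟨this.ge, this.le⟩
  · refine measure_mono_null ?_ (hplus (-1 + (y.1:ℝ)/N))
    rintro p ⟨⟨_, hp, _⟩, ⟨_, hp', _⟩⟩
    have := eq_endpoint_of_mem_intervals h hp'.2 hp.1
    exact ⟨this.ge, this.le⟩
  · refine measure_mono_null ?_ (hminus (-1 + (x.2:ℝ)/N))
    rintro p ⟨⟨_, _, hp⟩, ⟨_, _, hp'⟩⟩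
    have := eq_endpoint_of_mem_intervals h hp.2 hp'.1
    exact ⟨this.ge, this.le⟩
  · refine measure_mono_null ?_ (hminus (-1 + (y.2:ℝ)/N))
    rintro p ⟨⟨_, _, hp⟩, ⟨_, _, hp'⟩⟩
    have := eq_endpoint_of_mem_intervals h hp'.2 hp.1
    exact ⟨this.ge, this.le⟩

/-- If `A` is covered by `B` and four strips of width at most `w`, two in each diagonal
direction, then `γ(A) ≤ γ(B) + 4w`. -/
lemma queenon_le_add_strips {γ : ProbabilityMeasure (ℝ × ℝ)} (hγ : γ ∈ queenons)
    {A B : Set (ℝ × ℝ)} {w c₁ c₂ c₃ c₄ : ℝ} (hw : 0 ≤ w)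
    (h : ∀ p ∈ A, p ∈ B ∨ (c₁ ≤ p.1 + p.2 ∧ p.1 + p.2 ≤ c₁ + w) ∨
      (c₂ ≤ p.1 + p.2 ∧ p.1 + p.2 ≤ c₂ + w) ∨ (c₃ ≤ p.2 - p.1 ∧ p.2 - p.1 ≤ c₃ + w) ∨
      (c₄ ≤ p.2 - p.1 ∧ p.2 - p.1 ≤ c₄ + w)) :
    γ.toMeasure.real A ≤ γ.toMeasure.real B + 4 * w := by
  set S : ℝ → Set (ℝ × ℝ) := fun c => {p | c ≤ p.1 + p.2 ∧ p.1 + p.2 ≤ c + w}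
  set D : ℝ → Set (ℝ × ℝ) := fun c => {p | c ≤ p.2 - p.1 ∧ p.2 - p.1 ≤ c + w}
  have hS : ∀ c, γ.toMeasure.real (S c) ≤ w := fun c =>
    (queenon_plus_strip_le hγ (by linarith)).trans_eq (by ring)
  have hD : ∀ c, γ.toMeasure.real (D c) ≤ w := fun c =>
    (queenon_minus_strip_le hγ (by linarith)).trans_eq (by ring)
  have hsub : A ⊆ B ∪ (S c₁ ∪ (S c₂ ∪ (D c₃ ∪ D c₄))) := h
  have h0 := measureReal_mono (μ := γ.toMeasure) hsub
  have h1 := measureReal_union_le (μ := γ.toMeasure) B (S c₁ ∪ (S c₂ ∪ (D c₃ ∪ D c₄)))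
  have h2 := measureReal_union_le (μ := γ.toMeasure) (S c₁) (S c₂ ∪ (D c₃ ∪ D c₄))
  have h3 := measureReal_union_le (μ := γ.toMeasure) (S c₂) (D c₃ ∪ D c₄)
  have h4 := measureReal_union_le (μ := γ.toMeasure) (D c₃) (D c₄)
  linarith [hS c₁, hS c₂, hD c₃, hD c₄]

/-- The indices of the cells of `I_N` that can meet `Rset a₁ b₁ a₂ b₂`. -/
def outerCells (N : ℕ) (a₁ b₁ a₂ b₂ : ℝ) : Finset (ℕ × ℕ) :=
  (Finset.Icc 1 (2*N) ×ˢ Finset.Icc 1 (2*N)).filter fun x =>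
    (a₁ ≤ -1 + (x.1:ℝ)/N ∧ -1 + ((x.1:ℝ) - 1)/N ≤ b₁) ∧
    (a₂ ≤ -1 + (x.2:ℝ)/N ∧ -1 + ((x.2:ℝ) - 1)/N ≤ b₂)

/-- The indices of the cells of `I_N` whose defining strips lie within those of
`Rset a₁ b₁ a₂ b₂`. -/
def innerCells (N : ℕ) (a₁ b₁ a₂ b₂ : ℝ) : Finset (ℕ × ℕ) :=
  (Finset.Icc 1 (2*N) ×ˢ Finset.Icc 1 (2*N)).filter fun x =>
    (a₁ ≤ -1 + ((x.1:ℝ) - 1)/N ∧ -1 + (x.1:ℝ)/N ≤ b₁) ∧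
    (a₂ ≤ -1 + ((x.2:ℝ) - 1)/N ∧ -1 + (x.2:ℝ)/N ≤ b₂)

lemma sum_outerCells_le {γ : ProbabilityMeasure (ℝ × ℝ)} (hγ : γ ∈ queenons) (N : ℕ)
    (a₁ b₁ a₂ b₂ : ℝ) :
    ∑ x ∈ outerCells N a₁ b₁ a₂ b₂, γ.toMeasure.real (INcell N x.1 x.2) ≤
      γ.toMeasure.real (Rset a₁ b₁ a₂ b₂) + 4 * (1/(N:ℝ)) := by
  rw [← measureReal_biUnion_finset₀
    (fun x _ y _ hxy => queenon_INcell_aedisjoint hγ N hxy)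
    (fun x _ => (isClosed_INcell N x.1 x.2).measurableSet.nullMeasurableSet)]
  refine queenon_le_add_strips hγ (c₁ := a₁ - 1/N) (c₂ := b₁) (c₃ := a₂ - 1/N) (c₄ := b₂)
    (by positivity) fun p hp => ?_
  simp only [Set.mem_iUnion, outerCells, Finset.mem_filter, exists_prop] at hp
  obtain ⟨x, ⟨_, ⟨h1, h2⟩, h3, h4⟩, hsq, ⟨h5, h6⟩, h7, h8⟩ := hp
  rw [sub_div] at h2 h4 h5 h7
  by_cases g1 : p.1 + p.2 ≤ a₁
  · right; left; constructor <;> linarith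
  by_cases g2 : b₁ ≤ p.1 + p.2
  · right; right; left; constructor <;> linarith
  by_cases g3 : p.2 - p.1 ≤ a₂
  · right; right; right; left; constructor <;> linarith
  by_cases g4 : b₂ ≤ p.2 - p.1
  · right; right; right; right; constructor <;> linarith
  push Not at g1 g2 g3 g4
  exact Or.inl ⟨hsq, ⟨g1.le, g2.le⟩, g3.le, g4.le⟩

lemma le_sum_innerCells {γ : ProbabilityMeasure (ℝ × ℝ)} (hγ : γ ∈ queenons) {N : ℕ}
    (hN : 0 < N) (a₁ b₁ a₂ b₂ : ℝ) :
    γ.toMeasure.real (Rset a₁ b₁ a₂ b₂) ≤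
      ∑ x ∈ innerCells N a₁ b₁ a₂ b₂, γ.toMeasure.real (INcell N x.1 x.2) + 4 * (1/(N:ℝ)) := by
  refine le_trans ?_ (add_le_add_left (measureReal_biUnion_finset_le
    (μ := γ.toMeasure) (innerCells N a₁ b₁ a₂ b₂) fun x => INcell N x.1 x.2) _)
  refine queenon_le_add_strips hγ (c₁ := a₁) (c₂ := b₁ - 1/N) (c₃ := a₂) (c₄ := b₂ - 1/N)
    (by positivity) fun p hp => ?_
  obtain ⟨hsq, ⟨h1, h2⟩, h3, h4⟩ := hp
  obtain ⟨a, ha, b, hb, hcell⟩ := exists_mem_INcell hN hsq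
  obtain ⟨_, ⟨h5, h6⟩, h7, h8⟩ := id hcell
  by_cases g1 : a₁ ≤ -1 + ((a:ℝ) - 1)/N
  swap
  · rw [sub_div] at g1; right; left; constructor <;> linarith
  by_cases g2 : -1 + (a:ℝ)/N ≤ b₁
  swap
  · rw [sub_div] at h5; right; right; left; constructor <;> linarith
  by_cases g3 : a₂ ≤ -1 + ((b:ℝ) - 1)/N
  swap
  · rw [sub_div] at g3; right; right; right; left; constructor <;> linarith
  by_cases g4 : -1 + (b:ℝ)/N ≤ b₂
  swap
  · rw [sub_div] at h7; right; right; right; right; constructor <;> linarith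
  left
  simp only [Set.mem_iUnion, exists_prop]
  exact ⟨(a, b), Finset.mem_filter.mpr ⟨Finset.mem_product.mpr ⟨ha, hb⟩, ⟨g1, g2⟩, g3, g4⟩, hcell⟩

/-! ### Grid squares -/

lemma plus_mem_of_mem_gridSq {n i j : ℕ} {z : ℝ × ℝ} (hz : z ∈ gridSq n i j) :
    -1 + ((i:ℝ) + j - 2)/n ≤ z.1 + z.2 ∧ z.1 + z.2 ≤ -1 + ((i:ℝ) + j)/n := by
  obtain ⟨⟨h1, h2⟩, h3, h4⟩ := hz
  have e1 : ((i:ℝ) + j - 2)/n = ((i:ℝ) - 1)/n + ((j:ℝ) - 1)/n := by ring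
  have e2 : ((i:ℝ) + j)/n = (i:ℝ)/n + (j:ℝ)/n := by ring
  rw [e1, e2]
  constructor <;> linarith

lemma minus_mem_of_mem_gridSq {n i j : ℕ} {z : ℝ × ℝ} (hz : z ∈ gridSq n i j) :
    ((j:ℝ) - i - 1)/n ≤ z.2 - z.1 ∧ z.2 - z.1 ≤ ((j:ℝ) - i + 1)/n := by
  obtain ⟨⟨h1, h2⟩, h3, h4⟩ := hz
  have e1 : ((j:ℝ) - i - 1)/n = ((j:ℝ) - 1)/n - (i:ℝ)/n := by ring
  have e2 : ((j:ℝ) - i + 1)/n = (j:ℝ)/n - ((i:ℝ) - 1)/n := by ring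
  rw [e1, e2]
  constructor <;> linarith

lemma gridSq_subset_unitSq {n i j : ℕ} (hi : i ∈ Finset.Icc 1 n) (hj : j ∈ Finset.Icc 1 n) :
    gridSq n i j ⊆ unitSq := by
  have key : ∀ k ∈ Finset.Icc 1 n, 0 ≤ ((k:ℝ) - 1)/n ∧ (k:ℝ)/n ≤ 1 := by
    intro k hk
    obtain ⟨h1, h2⟩ := Finset.mem_Icc.mp hk
    have h1' : (1:ℝ) ≤ k := by exact_mod_cast h1
    have h2' : (k:ℝ) ≤ n := by exact_mod_cast h2
    exact ⟨div_nonneg (by linarith) (by positivity), div_le_one_of_le₀ h2' (by positivity)⟩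
  rintro z ⟨⟨h1, h2⟩, h3, h4⟩
  obtain ⟨h5, h6⟩ := key i hi
  obtain ⟨h7, h8⟩ := key j hj
  exact mem_unitSq.mpr ⟨⟨by linarith, by linarith⟩, by linarith, by linarith⟩

lemma gridSq_nonempty (n i j : ℕ) : (gridSq n i j).Nonempty := by
  have key : ∀ k : ℕ, -(1:ℝ)/2 + ((k:ℝ) - 1)/n ≤ -(1:ℝ)/2 + (k:ℝ)/n := fun k => by
    gcongr
    linarith
  exact ⟨(_, _), ⟨le_rfl, key i⟩, le_rfl, key j⟩

lemma volume_gridSq (n i j : ℕ) :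
    (volume : Measure (ℝ × ℝ)) (gridSq n i j) = ENNReal.ofReal (1/(n:ℝ) * (1/n)) := by
  rw [gridSq, Measure.volume_eq_prod, Measure.prod_prod, Real.volume_Icc, Real.volume_Icc,
    ← ENNReal.ofReal_mul]
  · congr 1
    ring
  · have : -(1:ℝ)/2 + (i:ℝ)/n - (-(1:ℝ)/2 + ((i:ℝ) - 1)/n) = 1/n := by ring
    rw [this]
    positivity

lemma gridSq_aedisjoint (n : ℕ) {i j i' j' : ℕ} (h : i ≠ i') :
    AEDisjoint (volume : Measure (ℝ × ℝ)) (gridSq n i j) (gridSq n i' j') := by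
  wlog hlt : i < i' generalizing i i' j j'
  · exact (this h.symm (by omega)).symm
  have hsub : gridSq n i j ∩ gridSq n i' j' ⊆ {-(1:ℝ)/2 + (i:ℝ)/n} ×ˢ Set.univ := by
    rintro z ⟨⟨hz, _⟩, ⟨hz', _⟩⟩
    refine ⟨le_antisymm hz.2 (le_trans ?_ hz'.1), trivial⟩
    have : (i:ℝ) + 1 ≤ i' := by exact_mod_cast hlt
    gcongr
    linarith
  refine measure_mono_null hsub ?_
  rw [Measure.volume_eq_prod, Measure.prod_prod]
  simp

/-- The position `ij` is assigned to a cell of `I_N` that meets the square of `ij`. -/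
lemma cellIndex_spec {N n : ℕ} (hN : 0 < N) {ij : ℕ × ℕ} (hi : ij.1 ∈ Finset.Icc 1 n)
    (hj : ij.2 ∈ Finset.Icc 1 n) :
    cellIndex N n ij ∈ Finset.Icc 1 (2*N) ×ˢ Finset.Icc 1 (2*N) ∧
      (INcell N (cellIndex N n ij).1 (cellIndex N n ij).2 ∩ gridSq n ij.1 ij.2).Nonempty := by
  classical
  set cand : Finset (ℕ × ℕ) :=
    (Finset.Icc 1 (2*N) ×ˢ Finset.Icc 1 (2*N)).filter fun ab =>
      (INcell N ab.1 ab.2 ∩ gridSq n ij.1 ij.2).Nonempty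
  set keyFn : ℕ × ℕ → ℤ ×ₗ ℤ := fun ab => toLex ((ab.1 : ℤ) - (ab.2 : ℤ), (ab.2 : ℤ)) with hkey
  have hne : cand.Nonempty := by
    obtain ⟨z, hz⟩ := gridSq_nonempty n ij.1 ij.2
    obtain ⟨a, ha, b, hb, hcell⟩ := exists_mem_INcell hN (gridSq_subset_unitSq hi hj hz)
    exact ⟨(a, b), Finset.mem_filter.mpr ⟨Finset.mem_product.mpr ⟨ha, hb⟩, z, hcell, hz⟩⟩
  obtain ⟨x, hx, hxmin⟩ := Finset.mem_image.mp
    ((cand.image keyFn).min'_mem (hne.image keyFn))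
  have hval : cellIndex N n ij = x := by
    have : cellIndex N n ij =
        (((ofLex ((cand.image keyFn).min' (hne.image keyFn))).1 +
          (ofLex ((cand.image keyFn).min' (hne.image keyFn))).2).toNat,
          ((ofLex ((cand.image keyFn).min' (hne.image keyFn))).2).toNat) := by
      unfold cellIndex
      convert dif_pos hne
    rw [this, ← hxmin]
    simp [hkey]
  rw [hval]
  exact Finset.mem_filter.mp hx

/-! ### Queens configurations -/

lemma card_filter_Icc_add_two_le {α : Type*} (q : Finset α) (f : α → ℤ)
    (hf : Set.InjOn f q) (m : ℝ) {P : α → Prop} [DecidablePred P]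
    (hP : ∀ p ∈ q, P p → m ≤ f p ∧ (f p : ℝ) ≤ m + 2) : (q.filter P).card ≤ 3 := by
  have h := Finset.card_le_card_of_injOn (s := q.filter P) (t := Finset.Icc ⌈m⌉ (⌈m⌉ + 2)) f
    (fun p hp => by
      obtain ⟨hpq, hpP⟩ := Finset.mem_filter.mp hp
      obtain ⟨h1, h2⟩ := hP p hpq hpP
      refine Finset.mem_coe.mpr (Finset.mem_Icc.mpr ⟨Int.ceil_le.mpr h1, ?_⟩)
      have h3 : (f p : ℝ) ≤ ((⌈m⌉ + 2 : ℤ) : ℝ) := by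
        push_cast
        linarith [Int.le_ceil m]
      exact_mod_cast h3)
    (hf.mono (by intro p hp; exact (Finset.mem_filter.mp hp).1))
  rw [Int.card_Icc] at h
  omega

open Classical in
/-- The queens whose square can meet one of the lines bounding `Rset a₁ b₁ a₂ b₂`. -/
def boundaryQueens (n : ℕ) (q : Finset (ℕ × ℕ)) (a₁ b₁ a₂ b₂ : ℝ) : Finset (ℕ × ℕ) :=
  q.filter (fun p => -1 + ((p.1:ℝ) + p.2 - 2)/n ≤ a₁ ∧ a₁ ≤ -1 + ((p.1:ℝ) + p.2)/n) ∪
  q.filter (fun p => -1 + ((p.1:ℝ) + p.2 - 2)/n ≤ b₁ ∧ b₁ ≤ -1 + ((p.1:ℝ) + p.2)/n) ∪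
  (q.filter (fun p => ((p.2:ℝ) - p.1 - 1)/n ≤ a₂ ∧ a₂ ≤ ((p.2:ℝ) - p.1 + 1)/n) ∪
  q.filter (fun p => ((p.2:ℝ) - p.1 - 1)/n ≤ b₂ ∧ b₂ ≤ ((p.2:ℝ) - p.1 + 1)/n))

lemma card_boundaryQueens_le {n : ℕ} (hn : 0 < n) {q : Finset (ℕ × ℕ)}
    (hq : IsQueensConfig n q) (a₁ b₁ a₂ b₂ : ℝ) :
    (boundaryQueens n q a₁ b₁ a₂ b₂).card ≤ 12 := by
  classical
  have hn' : (0:ℝ) < n := by exact_mod_cast hn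
  obtain ⟨-, -, -, hp, hm⟩ := hq
  have plus : ∀ c : ℝ, (q.filter (fun p : ℕ × ℕ =>
      -1 + ((p.1:ℝ) + p.2 - 2)/n ≤ c ∧ c ≤ -1 + ((p.1:ℝ) + p.2)/n)).card ≤ 3 := by
    intro c
    refine card_filter_Icc_add_two_le q (fun p => (p.1:ℤ) + p.2)
      (fun p hpq p' hpq' h => hp p hpq p' hpq' (by dsimp only at h; omega)) ((c + 1) * n) ?_
    rintro p - ⟨h1, h2⟩
    have h3 : ((p.1:ℝ) + p.2 - 2)/n ≤ c + 1 := by linarith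
    have h4 : c + 1 ≤ ((p.1:ℝ) + p.2)/n := by linarith
    rw [div_le_iff₀ hn'] at h3
    rw [le_div_iff₀ hn'] at h4
    push_cast
    constructor <;> linarith
  have minus : ∀ c : ℝ, (q.filter (fun p : ℕ × ℕ =>
      ((p.2:ℝ) - p.1 - 1)/n ≤ c ∧ c ≤ ((p.2:ℝ) - p.1 + 1)/n)).card ≤ 3 := by
    intro c
    refine card_filter_Icc_add_two_le q (fun p => (p.2:ℤ) - p.1)
      (fun p hpq p' hpq' h => hm p hpq p' hpq' h) (c * n - 1) ?_
    rintro p - ⟨h3, h4⟩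
    rw [div_le_iff₀ hn'] at h3
    rw [le_div_iff₀ hn'] at h4
    push_cast
    constructor <;> linarith
  unfold boundaryQueens
  refine (Finset.card_union_le _ _).trans (le_trans (add_le_add (Finset.card_union_le _ _)
    (Finset.card_union_le _ _)) ?_)
  have h1 := plus a₁
  have h2 := plus b₁
  have h3 := minus a₂
  have h4 := minus b₂
  convert add_le_add (add_le_add h1 h2) (add_le_add h3 h4)

lemma mem_boundaryQueens {n : ℕ} {q : Finset (ℕ × ℕ)} {a₁ b₁ a₂ b₂ : ℝ} {p : ℕ × ℕ}
    (hp : p ∈ q) {z w : ℝ × ℝ} (hz : z ∈ gridSq n p.1 p.2) (hw : w ∈ gridSq n p.1 p.2)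
    (h : (z.1 + z.2 ≤ a₁ ∧ a₁ ≤ w.1 + w.2) ∨ (z.1 + z.2 ≤ b₁ ∧ b₁ ≤ w.1 + w.2) ∨
      (z.2 - z.1 ≤ a₂ ∧ a₂ ≤ w.2 - w.1) ∨ (z.2 - z.1 ≤ b₂ ∧ b₂ ≤ w.2 - w.1)) :
    p ∈ boundaryQueens n q a₁ b₁ a₂ b₂ := by
  have zp := (plus_mem_of_mem_gridSq hz).1
  have wp := (plus_mem_of_mem_gridSq hw).2
  have zm := (minus_mem_of_mem_gridSq hz).1
  have wm := (minus_mem_of_mem_gridSq hw).2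
  simp only [boundaryQueens, Finset.mem_union, Finset.mem_filter]
  rcases h with h | h | h | h
  · exact Or.inl (Or.inl ⟨hp, zp.trans h.1, h.2.trans wp⟩)
  · exact Or.inl (Or.inr ⟨hp, zp.trans h.1, h.2.trans wp⟩)
  · exact Or.inr (Or.inl ⟨hp, zm.trans h.1, h.2.trans wm⟩)
  · exact Or.inr (Or.inr ⟨hp, zm.trans h.1, h.2.trans wm⟩)

open Classical in
/-- A queen whose square meets `Rset a₁ b₁ a₂ b₂` is assigned to an outer cell, or is a
boundary queen. -/
lemma filter_meets_subset {N n : ℕ} (hN : 0 < N) {q : Finset (ℕ × ℕ)}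
    (hq : IsQueensConfig n q) (a₁ b₁ a₂ b₂ : ℝ) :
    q.filter (fun p => (Rset a₁ b₁ a₂ b₂ ∩ gridSq n p.1 p.2).Nonempty) ⊆
      q.filter (fun p => cellIndex N n p ∈ outerCells N a₁ b₁ a₂ b₂) ∪
        boundaryQueens n q a₁ b₁ a₂ b₂ := by
  intro p hp
  obtain ⟨hpq, z, ⟨hzsq, hz1, hz2⟩, hz⟩ := Finset.mem_filter.mp hp
  obtain ⟨hidx, w, ⟨hwsq, hw1, hw2⟩, hw⟩ := cellIndex_spec hN (hq.1 p hpq).1 (hq.1 p hpq).2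
  rw [Finset.mem_union]
  by_cases g1 : a₁ ≤ -1 + ((cellIndex N n p).1:ℝ)/N
  swap
  · exact Or.inr (mem_boundaryQueens hpq hw hz (Or.inl ⟨by linarith, by linarith⟩))
  by_cases g2 : -1 + (((cellIndex N n p).1:ℝ) - 1)/N ≤ b₁
  swap
  · exact Or.inr (mem_boundaryQueens hpq hz hw (Or.inr (Or.inl ⟨by linarith, by linarith⟩)))
  by_cases g3 : a₂ ≤ -1 + ((cellIndex N n p).2:ℝ)/N
  swap
  · exact Or.inr (mem_boundaryQueens hpq hw hz
      (Or.inr (Or.inr (Or.inl ⟨by linarith, by linarith⟩))))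
  by_cases g4 : -1 + (((cellIndex N n p).2:ℝ) - 1)/N ≤ b₂
  swap
  · exact Or.inr (mem_boundaryQueens hpq hz hw
      (Or.inr (Or.inr (Or.inr ⟨by linarith, by linarith⟩))))
  exact Or.inl (Finset.mem_filter.mpr
    ⟨hpq, Finset.mem_filter.mpr ⟨hidx, ⟨g1, g2⟩, g3, g4⟩⟩)

open Classical in
/-- A queen assigned to an inner cell has its square inside `Rset a₁ b₁ a₂ b₂`, or is a
boundary queen. -/
lemma filter_innerCells_subset {N n : ℕ} (hN : 0 < N) {q : Finset (ℕ × ℕ)}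
    (hq : IsQueensConfig n q) (a₁ b₁ a₂ b₂ : ℝ) :
    q.filter (fun p => cellIndex N n p ∈ innerCells N a₁ b₁ a₂ b₂) ⊆
      q.filter (fun p => gridSq n p.1 p.2 ⊆ Rset a₁ b₁ a₂ b₂) ∪
        boundaryQueens n q a₁ b₁ a₂ b₂ := by
  intro p hp
  obtain ⟨hpq, hin⟩ := Finset.mem_filter.mp hp
  obtain ⟨-, ⟨g1, g2⟩, g3, g4⟩ := Finset.mem_filter.mp hin
  obtain ⟨-, w, ⟨hwsq, hw1, hw2⟩, hw⟩ := cellIndex_spec hN (hq.1 p hpq).1 (hq.1 p hpq).2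
  rw [Finset.mem_union, or_iff_not_imp_right]
  refine fun hnot => Finset.mem_filter.mpr ⟨hpq, fun z hz => ?_⟩
  refine ⟨gridSq_subset_unitSq (hq.1 p hpq).1 (hq.1 p hpq).2 hz, ⟨?_, ?_⟩, ?_, ?_⟩ <;>
    by_contra hcon <;> refine hnot ?_
  · exact mem_boundaryQueens hpq hz hw (Or.inl ⟨by linarith, by linarith⟩)
  · exact mem_boundaryQueens hpq hw hz (Or.inr (Or.inl ⟨by linarith, by linarith⟩))
  · exact mem_boundaryQueens hpq hz hw (Or.inr (Or.inr (Or.inl ⟨by linarith, by linarith⟩)))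
  · exact mem_boundaryQueens hpq hw hz (Or.inr (Or.inr (Or.inr ⟨by linarith, by linarith⟩)))

lemma sum_card_alphaFin_inter {N n : ℕ} {q : Finset (ℕ × ℕ)} (hq : IsQueensConfig n q)
    (T : Finset (ℕ × ℕ)) :
    ∑ x ∈ T, ((alphaFin N n x.1 x.2 ∩ q).card : ℝ) =
      (q.filter (fun p => cellIndex N n p ∈ T)).card := by
  rw [Finset.card_eq_sum_card_fiberwise (s := q.filter (fun p => cellIndex N n p ∈ T))
    (f := cellIndex N n) (t := T) (fun p hp => (Finset.mem_filter.mp (Finset.mem_coe.mp hp)).2)]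
  push_cast
  refine Finset.sum_congr rfl fun x hx => ?_
  congr 2
  ext p
  simp only [alphaFin, Finset.mem_inter, Finset.mem_filter, Finset.mem_product, Prod.mk.eta]
  constructor
  · rintro ⟨⟨_, h⟩, hpq⟩
    exact ⟨⟨hpq, h ▸ hx⟩, h⟩
  · rintro ⟨⟨hpq, _⟩, h⟩
    exact ⟨⟨hq.1 p hpq, h⟩, hpq⟩

lemma gammaOf_apply (n : ℕ) (q : Finset (ℕ × ℕ)) {s : Set (ℝ × ℝ)} (hs : MeasurableSet s) :
    gammaOf n q s = n * volume (s ∩ ⋃ p ∈ q, gridSq n p.1 p.2) := by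
  have hU : MeasurableSet (⋃ p ∈ q, gridSq n p.1 p.2) :=
    Finset.measurableSet_biUnion q fun p _ => (isClosed_gridSq n p.1 p.2).measurableSet
  rw [gammaOf, withDensity_indicator hU, withDensity_const, Measure.smul_apply,
    Measure.restrict_apply hs, smul_eq_mul]

lemma natCast_mul_sum_volume_gridSq {n : ℕ} (hn : 0 < n) (K : Finset (ℕ × ℕ)) :
    (n : ℝ≥0∞) * ∑ p ∈ K, volume (gridSq n p.1 p.2) = ENNReal.ofReal (K.card / n) := by
  have hn' : (n:ℝ) ≠ 0 := by positivity
  simp_rw [volume_gridSq]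
  rw [Finset.sum_const, nsmul_eq_mul, ← ENNReal.ofReal_natCast n, ← ENNReal.ofReal_natCast K.card,
    ← ENNReal.ofReal_mul (by positivity), ← ENNReal.ofReal_mul (by positivity)]
  congr 1
  field_simp

open Classical in
lemma gammaOf_le {n : ℕ} (hn : 0 < n) (q : Finset (ℕ × ℕ)) {s : Set (ℝ × ℝ)}
    (hs : MeasurableSet s) : gammaOf n q s ≤
      ENNReal.ofReal ((q.filter (fun p => (s ∩ gridSq n p.1 p.2).Nonempty)).card / n) := by
  rw [gammaOf_apply n q hs, ← natCast_mul_sum_volume_gridSq hn]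
  gcongr
  refine (measure_mono ?_).trans (measure_biUnion_finset_le _ _)
  rintro z ⟨hzs, hz⟩
  simp only [Set.mem_iUnion, exists_prop, Finset.mem_filter] at hz ⊢
  obtain ⟨p, hp, hz⟩ := hz
  exact ⟨p, ⟨hp, z, hzs, hz⟩, hz⟩

open Classical in
lemma le_gammaOf {n : ℕ} (hn : 0 < n) {q : Finset (ℕ × ℕ)} (hq : IsQueensConfig n q)
    {s : Set (ℝ × ℝ)} (hs : MeasurableSet s) :
    ENNReal.ofReal ((q.filter (fun p => gridSq n p.1 p.2 ⊆ s)).card / n) ≤ gammaOf n q s := by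
  rw [gammaOf_apply n q hs, ← natCast_mul_sum_volume_gridSq hn, ← measure_biUnion_finset₀]
  · gcongr
    refine Set.iUnion₂_subset fun p hp => ?_
    obtain ⟨hpq, hps⟩ := Finset.mem_filter.mp hp
    exact Set.subset_inter hps (Set.subset_biUnion_of_mem (u := fun p : ℕ × ℕ =>
      gridSq n p.1 p.2) hpq)
  · intro p hp p' hp' hne
    have hpq := (Finset.mem_filter.mp hp).1
    have hpq' := (Finset.mem_filter.mp hp').1
    refine gridSq_aedisjoint n fun h => hne (Prod.ext h ?_)
    refine (hq.2.2.1 p.1 (hq.1 p hpq).1).unique hpq ?_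
    rw [h]
    exact hpq'
  · exact fun p _ => (isClosed_gridSq n p.1 p.2).measurableSet.nullMeasurableSet

/-- **Claim (configurations approximating a queenon).**
If an `n`-queens configuration `q` satisfies `|α_n ∩ q| = (γ(α) ± ε)n` for every
`α ∈ I_N`, then `d(γ_q, γ) ≤ 4N²(ε + 8/n) + 8/N`. -/
theorem config_to_queenon_approximation (γ : ProbabilityMeasure (ℝ × ℝ))
    (hγ : γ ∈ queenons) (N n : ℕ) (hN : 0 < N) (hn : 0 < n) (ε : ℝ) (hε : 0 < ε)
    (q : Finset (ℕ × ℕ)) (hq : IsQueensConfig n q)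
    (happrox : ∀ a ∈ Finset.Icc 1 (2*N), ∀ b ∈ Finset.Icc 1 (2*N),
      |((alphaFin N n a b ∩ q).card : ℝ) -
        (γ.toMeasure (INcell N a b)).toReal * (n : ℝ)| ≤ ε * n) :
    qdist (gammaOf n q) γ.toMeasure ≤ 4*(N:ℝ)^2*(ε + 8/(n:ℝ)) + 8/(N:ℝ) := by
  classical
  have hn' : (0:ℝ) < n := by exact_mod_cast hn
  have hN' : (1:ℝ) ≤ N := by exact_mod_cast hN
  refine Real.sSup_le ?_ (by positivity)
  rintro t ⟨a₁, b₁, a₂, b₂, -, -, -, -, rfl⟩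
  have hs := (isClosed_Rset a₁ b₁ a₂ b₂).measurableSet
  have hE : ((boundaryQueens n q a₁ b₁ a₂ b₂).card : ℝ) ≤ 12 := by
    exact_mod_cast card_boundaryQueens_le hn hq a₁ b₁ a₂ b₂
  have hdisc : ∀ T ⊆ Finset.Icc 1 (2*N) ×ˢ Finset.Icc 1 (2*N),
      |((q.filter (fun p => cellIndex N n p ∈ T)).card : ℝ) -
        (∑ x ∈ T, γ.toMeasure.real (INcell N x.1 x.2)) * n| ≤ 4*(N:ℝ)^2*ε*n := by
    intro T hT
    rw [← sum_card_alphaFin_inter hq, Finset.sum_mul, ← Finset.sum_sub_distrib]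
    refine (Finset.abs_sum_le_sum_abs _ _).trans ?_
    refine (Finset.sum_le_card_nsmul T _ (ε * n) fun x hx => ?_).trans ?_
    · obtain ⟨h1, h2⟩ := Finset.mem_product.mp (hT hx)
      exact happrox x.1 h1 x.2 h2
    · have hcard : (T.card : ℝ) ≤ 4*(N:ℝ)^2 := by
        have := Finset.card_le_card hT
        rw [Finset.card_product, Nat.card_Icc] at this
        calc (T.card : ℝ) ≤ (((2*N + 1 - 1) * (2*N + 1 - 1) : ℕ) : ℝ) := by exact_mod_cast this
          _ = 4*(N:ℝ)^2 := by rw [Nat.add_sub_cancel]; push_cast; ring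
      rw [nsmul_eq_mul]
      calc (T.card : ℝ) * (ε * n) ≤ 4*(N:ℝ)^2 * (ε * n) := by gcongr
        _ = _ := by ring
  have hbound : 4*(N:ℝ)^2*ε + 12/n + 4*(1/(N:ℝ)) ≤ 4*(N:ℝ)^2*(ε + 8/(n:ℝ)) + 8/(N:ℝ) := by
    have h1 : 12/(n:ℝ) ≤ 4*(N:ℝ)^2*(8/(n:ℝ)) := by
      rw [← mul_div_assoc]
      gcongr
      nlinarith
    have h2 : 4*(1/(N:ℝ)) ≤ 8/(N:ℝ) := by
      rw [← mul_div_assoc]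
      gcongr
      norm_num
    linarith
  have hfin : gammaOf n q (Rset a₁ b₁ a₂ b₂) ≠ ∞ :=
    ne_top_of_le_ne_top ENNReal.ofReal_ne_top (gammaOf_le hn q hs)
  refine le_trans (abs_sub_le_iff.mpr ⟨?_, ?_⟩) hbound
  · have h1 := ENNReal.toReal_le_of_le_ofReal (by positivity) (gammaOf_le hn q hs)
    have h2 : ((q.filter (fun p =>
        (Rset a₁ b₁ a₂ b₂ ∩ gridSq n p.1 p.2).Nonempty)).card : ℝ) ≤
        (q.filter (fun p => cellIndex N n p ∈ outerCells N a₁ b₁ a₂ b₂)).card +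
          (boundaryQueens n q a₁ b₁ a₂ b₂).card := by
      exact_mod_cast (Finset.card_le_card (filter_meets_subset hN hq a₁ b₁ a₂ b₂)).trans
        (Finset.card_union_le _ _)
    have h3 := (abs_le.mp (hdisc (outerCells N a₁ b₁ a₂ b₂) (Finset.filter_subset _ _))).2
    have h4 := sum_outerCells_le hγ N a₁ b₁ a₂ b₂
    set X := ∑ x ∈ outerCells N a₁ b₁ a₂ b₂, γ.toMeasure.real (INcell N x.1 x.2)
    have h5 : ((q.filter (fun p =>
        (Rset a₁ b₁ a₂ b₂ ∩ gridSq n p.1 p.2).Nonempty)).card : ℝ) / n ≤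
        X + 4*(N:ℝ)^2*ε + 12/n := by
      rw [div_le_iff₀ hn', add_mul, add_mul, div_mul_cancel₀ _ hn'.ne']
      linarith
    rw [measureReal_def] at h4
    linarith
  · have h1 := (ENNReal.ofReal_le_iff_le_toReal hfin).mp (le_gammaOf hn hq hs)
    have h2 : ((q.filter (fun p => cellIndex N n p ∈ innerCells N a₁ b₁ a₂ b₂)).card : ℝ) ≤
        (q.filter (fun p => gridSq n p.1 p.2 ⊆ Rset a₁ b₁ a₂ b₂)).card +
          (boundaryQueens n q a₁ b₁ a₂ b₂).card := by
      exact_mod_cast (Finset.card_le_card (filter_innerCells_subset hN hq a₁ b₁ a₂ b₂)).trans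
        (Finset.card_union_le _ _)
    have h3 := (abs_le.mp (hdisc (innerCells N a₁ b₁ a₂ b₂) (Finset.filter_subset _ _))).1
    have h4 := le_sum_innerCells hγ hN a₁ b₁ a₂ b₂
    set X := ∑ x ∈ innerCells N a₁ b₁ a₂ b₂, γ.toMeasure.real (INcell N x.1 x.2)
    have h5 : X - 4*(N:ℝ)^2*ε - 12/n ≤
        ((q.filter (fun p => gridSq n p.1 p.2 ⊆ Rset a₁ b₁ a₂ b₂)).card : ℝ) / n := by
      rw [le_div_iff₀ hn', sub_mul, sub_mul, div_mul_cancel₀ _ hn'.ne']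
      linarith
    rw [measureReal_def] at h4
    linarith

end
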